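/- Let $a \geq 1$ and $m \geq 1$ be integers, and let $f_0(n) = \binom{a}{n-1}$. Then for every integer $n \geq 1$, $f_m(n) = \sum_{i=1}^{n} m^{i-1} \binom{ia}{n-i}$. -/

import Mathlib

/-- `c1 f0 n k` : the sum over all compositions `i₁ + ⋯ + i_k = n` of `n` into `k`
positive parts of the products `f0 i₁ ⋯ f0 i_k`. -/
def c1 (f0 : ℕ → ℕ) (n k : ℕ) : ℕ :=
  ∑ x ∈ (Finset.Nat.antidiagonalTuple k n).filter (fun x => ∀ t, 0 < x t),
    ∏ t, f0 (x t)

/-- `fm f0 m` is the `m`-th invert transform of `f0`: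
`f_0 = f0` and `f_m (n) = ∑_{k=1}^n c_m (n,k)` for `m ≥ 1`, where
`c_m = c1` applied to `f_{m-1}`. -/
def fm (f0 : ℕ → ℕ) : ℕ → ℕ → ℕ
  | 0 => f0
  | m + 1 => fun n => ∑ k ∈ Finset.Icc 1 n, c1 (fm f0 m) n k

open PowerSeries in
/-- If `F` has no constant term, the series `∑_{k ≥ 1} c ^ (k - 1) F ^ k`, given by its
coefficients, equals `F / (1 - c F)`. -/
theorem mk_sum_pow_mul_one_sub {R : Type*} [CommRing R] (c : R) {F : R⟦X⟧}
    (hF : constantCoeff F = 0) :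
    (mk fun n => ∑ k ∈ Finset.Icc 1 n, c ^ (k - 1) * coeff n (F ^ k)) * (1 - C c * F) = F := by
  set G : R⟦X⟧ := mk fun n => ∑ k ∈ Finset.Icc 1 n, c ^ (k - 1) * coeff n (F ^ k) with hG
  have hX (k : ℕ) : X ^ k ∣ F ^ k := pow_dvd_pow_of_dvd (X_dvd_iff.2 hF) k
  ext n
  set S : R⟦X⟧ := ∑ k ∈ Finset.Icc 1 n, C (c ^ (k - 1)) * F ^ k with hS
  have hGS : X ^ (n + 1) ∣ G - S := by
    refine X_pow_dvd_iff.2 fun j hj => ?_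
    rw [map_sub, sub_eq_zero, hG, hS, coeff_mk, map_sum]
    simp only [coeff_C_mul]
    refine Finset.sum_subset (Finset.Icc_subset_Icc_right (by lia)) fun k _ hk' => ?_
    rw [X_pow_dvd_iff.1 (hX k) j (by simp_all), mul_zero]
  have hSF : S * (1 - C c * F) = F - C (c ^ n) * F ^ (n + 1) := by
    rw [hS]
    clear hGS hS S
    induction n with
    | zero => simp
    | succ n ih =>
      rw [Finset.sum_Icc_succ_top (by lia), add_mul, ih]
      simp only [map_pow, Nat.add_sub_cancel]
      ring
  have hdvd : X ^ (n + 1) ∣ G * (1 - C c * F) - F := by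
    have h : G * (1 - C c * F) - F = (G - S) * (1 - C c * F) - C (c ^ n) * F ^ (n + 1) := by
      rw [sub_mul, hSF]; ring
    rw [h]
    exact dvd_sub (hGS.mul_right _) ((hX (n + 1)).mul_left _)
  have := X_pow_dvd_iff.1 hdvd n n.lt_succ_self
  rwa [map_sub, sub_eq_zero] at this

open PowerSeries in
/-- The generating function `∑_{n ≥ 1} f n X ^ n`. -/
noncomputable def genFun (f : ℕ → ℕ) : ℤ⟦X⟧ :=
  mk fun n => if n = 0 then 0 else (f n : ℤ)

theorem constantCoeff_genFun (f : ℕ → ℕ) : PowerSeries.constantCoeff (genFun f) = 0 := by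
  simp [genFun, ← PowerSeries.coeff_zero_eq_constantCoeff_apply]

theorem coeff_genFun (f : ℕ → ℕ) {n : ℕ} (hn : 1 ≤ n) :
    PowerSeries.coeff n (genFun f) = f n := by
  simp [genFun, Nat.one_le_iff_ne_zero.1 hn]

theorem coeff_genFun_pow (f : ℕ → ℕ) (n k : ℕ) :
    PowerSeries.coeff n (genFun f ^ k) = c1 f n k := by
  have hpow : genFun f ^ k = ∏ _t : Fin k, genFun f := by simp
  rw [hpow, PowerSeries.coeff_prod, c1, Nat.cast_sum, Finset.sum_filter]
  refine Finset.sum_bij (fun l _ => ⇑l) ?_ (fun _ _ _ _ h => DFunLike.coe_injective h) ?_ ?_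
  · intro l hl
    simpa [Finset.Nat.mem_antidiagonalTuple] using hl
  · intro x hx
    refine ⟨Finsupp.equivFunOnFinite.symm x, ?_, by simp⟩
    simpa [Finset.Nat.mem_antidiagonalTuple] using hx
  · intro l _
    split_ifs with h
    · rw [Nat.cast_prod]
      exact Finset.prod_congr rfl fun t _ => coeff_genFun f (h t)
    · push Not at h
      obtain ⟨t, ht⟩ := h
      refine Finset.prod_eq_zero (Finset.mem_univ t) ?_
      simp [Nat.le_zero.1 ht, constantCoeff_genFun]

theorem genFun_fm_succ_mul (f : ℕ → ℕ) (m : ℕ) :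
    genFun (fm f (m + 1)) * (1 - genFun (fm f m)) = genFun (fm f m) := by
  have h := mk_sum_pow_mul_one_sub (1 : ℤ) (constantCoeff_genFun (fm f m))
  rw [map_one, one_mul] at h
  convert h using 2
  ext n
  rcases Nat.eq_zero_or_pos n with rfl | hn
  · simp [constantCoeff_genFun]
  · simp [coeff_genFun _ hn, coeff_genFun_pow, fm]

theorem genFun_fm_mul (f : ℕ → ℕ) (m : ℕ) :
    genFun (fm f m) * (1 - PowerSeries.C (m : ℤ) * genFun f) = genFun f := by
  induction m with
  | zero => simp [fm]
  | succ m ih =>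
    have h := genFun_fm_succ_mul f m
    push_cast [map_add, map_one]
    linear_combination (1 - PowerSeries.C (m : ℤ) * genFun f) * h +
      (1 + genFun (fm f (m + 1))) * ih

open PowerSeries in
theorem genFun_choose (a : ℕ) :
    genFun (fun i => a.choose (i - 1)) = X * (1 + X) ^ a := by
  ext n
  rcases n with _ | n
  · simp [constantCoeff_genFun]
  · have h := Polynomial.coeff_one_add_X_pow ℤ a n
    rw [← Polynomial.coeff_coe] at h
    rw [coeff_genFun _ (by lia), coeff_succ_X_mul]
    simpa using h.symm

open PowerSeries in
theorem coeff_genFun_choose_pow (a : ℕ) {n k : ℕ} (hk : k ≤ n) :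
    coeff n (genFun (fun i => a.choose (i - 1)) ^ k) = (k * a).choose (n - k) := by
  have h := Polynomial.coeff_one_add_X_pow ℤ (k * a) (n - k)
  rw [← Polynomial.coeff_coe] at h
  rw [genFun_choose, mul_pow, ← pow_mul, coeff_X_pow_mul', if_pos hk, mul_comm a]
  simpa using h

theorem stmt_2 (a m : ℕ) (ha : 1 ≤ a) (hm : 1 ≤ m) (n : ℕ) (hn : 1 ≤ n) :
    fm (fun i => a.choose (i - 1)) m n =
      ∑ i ∈ Finset.Icc 1 n, m ^ (i - 1) * (i * a).choose (n - i) := by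
  set f : ℕ → ℕ := fun i => a.choose (i - 1) with hf
  have hne : (1 - PowerSeries.C (m : ℤ) * genFun f) ≠ 0 := fun h => by
    simpa [constantCoeff_genFun] using congrArg PowerSeries.constantCoeff h
  have h := mul_right_cancel₀ hne ((genFun_fm_mul f m).trans
    (mk_sum_pow_mul_one_sub (m : ℤ) (constantCoeff_genFun f)).symm)
  have hcoeff := congrArg (PowerSeries.coeff n) h
  rw [coeff_genFun _ hn, PowerSeries.coeff_mk] at hcoeff
  zify
  rw [hcoeff]
  refine Finset.sum_congr rfl fun k hk => ?_
  rw [hf, coeff_genFun_choose_pow a (Finset.mem_Icc.1 hk).2]
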